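/- Let f be standard self-concordant on an open convex set dom f ⊆ ℝⁿ, g : ℝⁿ → ℝ ∪ {+∞} proper, lower semicontinuous and convex, F := f + g, x* its unique minimizer with ∇²f(x*) ≻ 0, and consider a full-step proximal-Newton iterate x^k with direction d^k and decrement λ_k := ‖d^k‖_{x^k}, r_k := ‖x^k − x*‖_{x*}. If r_k ≤ r* where r* ≈ 0.08763 is the point where the function s(r) := (1−r)(1−7r+3r²)r/(1−4r+2r²) attains its maximum on [0, r*], then (1−r_k)(1−7r_k+3r_k²)r_k/(1−4r_k+2r_k²) ≤ λ_k and (1−r_k)(1−7r_k+3r_k²)/(1−4r_k+2r_k²) ≥ 1/2, hence r_k ≤ 2λ_k. In particular, λ_k ≤ ε implies ‖x^k − x*‖_{x*} ≤ 2ε. -/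

import Mathlib

open Matrix Set Filter Topology

noncomputable section

variable {n : ℕ}

/-- Weighted (semi)norm induced by a matrix `H`: `‖z‖_H = √(zᵀ H z)`. -/
def mNorm (H : Matrix (Fin n) (Fin n) ℝ) (z : Fin n → ℝ) : ℝ :=
  Real.sqrt (z ⬝ᵥ H.mulVec z)

/-- Dual weighted norm, `‖z‖*_H = √(zᵀ H⁻¹ z)`. -/
def mDualNorm (H : Matrix (Fin n) (Fin n) ℝ) (z : Fin n → ℝ) : ℝ :=
  Real.sqrt (z ⬝ᵥ H⁻¹.mulVec z)

/-- A function `g : ℝⁿ → ℝ ∪ {+∞}` (modelled with values in `EReal`) is proper. -/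
def EProper (g : (Fin n → ℝ) → EReal) : Prop :=
  (∀ x, g x ≠ ⊥) ∧ ∃ x, g x ≠ ⊤

/-- Convexity of an `EReal`-valued function on `ℝⁿ`. -/
def EConvex (g : (Fin n → ℝ) → EReal) : Prop :=
  ∀ x y : Fin n → ℝ, ∀ a b : ℝ, 0 ≤ a → 0 ≤ b → a + b = 1 →
    g (a • x + b • y) ≤ (a : EReal) * g x + (b : EReal) * g y

/-- `v` is a subgradient of `g` at `x`. -/
def ESubgradAt (g : (Fin n → ℝ) → EReal) (v x : Fin n → ℝ) : Prop :=
  g x ≠ ⊤ ∧ ∀ y, g x + ((v ⬝ᵥ (y - x) : ℝ) : EReal) ≤ g y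

/-- Objective of the proximal subproblem `g(x) + ½ xᵀHx − uᵀx`. -/
def proxObj (H : Matrix (Fin n) (Fin n) ℝ) (g : (Fin n → ℝ) → EReal)
    (u x : Fin n → ℝ) : EReal :=
  g x + ((1 / 2 * (x ⬝ᵥ H.mulVec x) - u ⬝ᵥ x : ℝ) : EReal)

/-- `p` solves the proximal subproblem, i.e. `p = P^g_H(u)`. -/
def IsProxPt (H : Matrix (Fin n) (Fin n) ℝ) (g : (Fin n → ℝ) → EReal)
    (u p : Fin n → ℝ) : Prop :=
  ∀ x, proxObj H g u p ≤ proxObj H g u x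

/-- The continuous linear map `y ↦ vᵀy`. -/
def dotCLM (v : Fin n → ℝ) : (Fin n → ℝ) →L[ℝ] ℝ :=
  LinearMap.toContinuousLinearMap
    { toFun := fun y => v ⬝ᵥ y
      map_add' := fun a b => dotProduct_add v a b
      map_smul' := fun c a => by simp }

/-- `f` is standard self-concordant on the open convex set `D`. -/
def StdSelfConcordantOn (D : Set (Fin n → ℝ)) (f : (Fin n → ℝ) → ℝ) : Prop :=
  IsOpen D ∧ Convex ℝ D ∧ ConvexOn ℝ D f ∧ ContDiffOn ℝ 3 f D ∧
    ∀ x ∈ D, ∀ v : Fin n → ℝ, ∀ t : ℝ, x + t • v ∈ D →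
      |iteratedDeriv 3 (fun s : ℝ => f (x + s • v)) t| ≤
        2 * iteratedDeriv 2 (fun s : ℝ => f (x + s • v)) t ^ ((3 : ℝ) / 2)

open scoped Classical in
/-- The extended objective `F = f + g`, equal to `+∞` outside `dom f`. -/
def Fext (D : Set (Fin n → ℝ)) (f : (Fin n → ℝ) → ℝ) (g : (Fin n → ℝ) → EReal)
    (x : Fin n → ℝ) : EReal :=
  if x ∈ D then (f x : EReal) + g x else ⊤

def omega (t : ℝ) : ℝ := t - Real.log (1 + t)

def omegaStar (t : ℝ) : ℝ := -t - Real.log (1 - t)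

lemma monotoneOn_Icc_of_hasDerivAt_nonneg {φ φ' : ℝ → ℝ} {u v : ℝ}
    (hφ : ∀ t ∈ Icc u v, HasDerivAt φ (φ' t) t) (h0 : ∀ t ∈ Icc u v, 0 ≤ φ' t) :
    MonotoneOn φ (Icc u v) :=
  monotoneOn_of_hasDerivWithinAt_nonneg (convex_Icc u v)
    (fun t ht => (hφ t ht).continuousAt.continuousWithinAt)
    (fun t ht => (hφ t (interior_subset ht)).hasDerivWithinAt)
    (fun t ht => h0 t (interior_subset ht))

/-- A nonnegative function with `|a'| ≤ K a` that is positive at `0` stays positive. -/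
lemma pos_of_abs_deriv_le_mul {a a' : ℝ → ℝ} {K : ℝ}
    (ha : ∀ t ∈ Icc (0 : ℝ) 1, HasDerivAt a (a' t) t)
    (hb : ∀ t ∈ Icc (0 : ℝ) 1, |a' t| ≤ K * a t) (h0 : 0 < a 0) :
    ∀ t ∈ Icc (0 : ℝ) 1, 0 < a t := by
  have hm : MonotoneOn (fun t => a t * Real.exp (K * t)) (Icc 0 1) := by
    refine monotoneOn_Icc_of_hasDerivAt_nonneg
      (φ' := fun t => a' t * Real.exp (K * t) + a t * (Real.exp (K * t) * (K * 1)))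
      (fun t ht => (ha t ht).mul (((hasDerivAt_id t).const_mul K).exp)) (fun t ht => ?_)
    have h1 := (abs_le.1 (hb t ht)).1
    have h2 := Real.exp_pos (K * t)
    nlinarith
  intro t ht
  have h := hm (left_mem_Icc.2 zero_le_one) ht ht.1
  simp only [mul_zero, Real.exp_zero, mul_one] at h
  exact pos_of_mul_pos_left (h0.trans_le h) (Real.exp_pos _).le

/-- Local-norm growth along a segment for a function with `|a'| ≤ 2 a^{3/2}`. -/
lemma sqrt_bounds_of_selfConcordant {a a' : ℝ → ℝ}
    (ha : ∀ t ∈ Icc (0 : ℝ) 1, HasDerivAt a (a' t) t)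
    (hn : ∀ t ∈ Icc (0 : ℝ) 1, 0 ≤ a t)
    (hb : ∀ t ∈ Icc (0 : ℝ) 1, |a' t| ≤ 2 * (a t * √(a t)))
    (h0 : 0 < a 0) (hr : √(a 0) < 1) :
    (∀ t ∈ Icc (0 : ℝ) 1, √(a t) ≤ √(a 0) / (1 - √(a 0))) ∧
      √(a 0) / (1 + √(a 0)) ≤ √(a 1) := by
  have hcont : ContinuousOn (fun t => √(a t)) (Icc 0 1) :=
    fun t ht => ((ha t ht).continuousAt.sqrt).continuousWithinAt
  obtain ⟨K, hK⟩ := isCompact_Icc.bddAbove_image hcont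
  have hpos : ∀ t ∈ Icc (0 : ℝ) 1, 0 < a t := by
    refine pos_of_abs_deriv_le_mul (K := 2 * K) ha (fun t ht => (hb t ht).trans ?_) h0
    have h1 : √(a t) ≤ K := hK ⟨t, ht, rfl⟩
    nlinarith [mul_le_mul_of_nonneg_left h1 (hn t ht)]
  have hd : ∀ t ∈ Icc (0 : ℝ) 1,
      HasDerivAt (fun t => (√(a t))⁻¹) (-(a' t / (2 * √(a t))) / √(a t) ^ 2) t :=
    fun t ht => ((ha t ht).sqrt (hpos t ht).ne').inv (Real.sqrt_pos.2 (hpos t ht)).ne'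
  have hd1 : ∀ t ∈ Icc (0 : ℝ) 1, |(-(a' t / (2 * √(a t))) / √(a t) ^ 2)| ≤ 1 := by
    intro t ht
    have hs := Real.sqrt_pos.2 (hpos t ht)
    have h2 := hb t ht
    rw [abs_div, abs_neg, abs_div, abs_of_pos (by positivity : 0 < √(a t) ^ 2),
      abs_of_pos (by positivity : 0 < 2 * √(a t)), div_div, div_le_one (by positivity)]
    have h3 := Real.sq_sqrt (hn t ht)
    calc |a' t| ≤ 2 * (a t * √(a t)) := h2
      _ = _ := by rw [h3]; ring
  have hm1 : MonotoneOn (fun t => (√(a t))⁻¹ + t) (Icc 0 1) :=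
    monotoneOn_Icc_of_hasDerivAt_nonneg (fun t ht => (hd t ht).add (hasDerivAt_id t))
      (fun t ht => by linarith [(abs_le.1 (hd1 t ht)).1])
  have hm2 : MonotoneOn (fun t => t - (√(a t))⁻¹) (Icc 0 1) :=
    monotoneOn_Icc_of_hasDerivAt_nonneg (fun t ht => (hasDerivAt_id t).sub (hd t ht))
      (fun t ht => by linarith [(abs_le.1 (hd1 t ht)).2])
  have hz : (0 : ℝ) ∈ Icc (0 : ℝ) 1 := left_mem_Icc.2 zero_le_one
  have ho : (1 : ℝ) ∈ Icc (0 : ℝ) 1 := right_mem_Icc.2 zero_le_one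
  have hs0 := Real.sqrt_pos.2 h0
  constructor
  · intro t ht
    have h := hm1 hz ht ht.1
    have hs := Real.sqrt_pos.2 (hpos t ht)
    simp only [add_zero] at h
    have h4 : (√(a 0))⁻¹ ≤ (√(a t))⁻¹ + 1 := h.trans (by linarith [ht.2])
    rw [le_div_iff₀ (by linarith)]
    have h5 := mul_le_mul_of_nonneg_left h4 (mul_pos hs hs0).le
    field_simp at h5
    linarith
  · have h := hm2 hz ho zero_le_one
    have hs := Real.sqrt_pos.2 (hpos 1 ho)
    simp only [zero_sub] at h
    have h4 : (√(a 1))⁻¹ ≤ (√(a 0))⁻¹ + 1 := by linarith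
    rw [div_le_iff₀ (by linarith)]
    have h5 := mul_le_mul_of_nonneg_left h4 (mul_pos hs hs0).le
    field_simp at h5
    linarith

/-- Gradient deviation bound along a segment: if the mixed third derivatives are controlled with
constant `3` and the step is short, the linearization error is at most `9/5 p² √(b 1)`. -/
lemma linearization_error_le {b b' c c' m : ℝ → ℝ} {p : ℝ} (hp : 0 ≤ p) (hp' : p ≤ 21 / 200)
    (hb : ∀ t ∈ Icc (0 : ℝ) 1, HasDerivAt b (b' t) t)
    (hc : ∀ t ∈ Icc (0 : ℝ) 1, HasDerivAt c (c' t) t)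
    (hm : ∀ t ∈ Icc (0 : ℝ) 1, HasDerivAt m (c t) t)
    (hb' : ∀ t ∈ Icc (0 : ℝ) 1, |b' t| ≤ 3 * p * b t)
    (hc' : ∀ q : ℝ, 0 < q → ∀ t ∈ Icc (0 : ℝ) 1, b t ≤ q ^ 2 → |c' t| ≤ 3 * p ^ 2 * q)
    (hb1 : 0 < b 1) :
    -(9 / 5 * p ^ 2 * √(b 1)) ≤ m 1 - m 0 - c 1 := by
  have ho : (1 : ℝ) ∈ Icc (0 : ℝ) 1 := right_mem_Icc.2 zero_le_one
  have hz : (0 : ℝ) ∈ Icc (0 : ℝ) 1 := left_mem_Icc.2 zero_le_one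
  have hmb : MonotoneOn (fun t => b t * Real.exp (3 * p * t)) (Icc 0 1) := by
    refine monotoneOn_Icc_of_hasDerivAt_nonneg
      (φ' := fun t => b' t * Real.exp (3 * p * t)
        + b t * (Real.exp (3 * p * t) * (3 * p * 1)))
      (fun t ht => (hb t ht).mul (((hasDerivAt_id t).const_mul _).exp)) (fun t ht => ?_)
    have h1 := (abs_le.1 (hb' t ht)).1
    have h2 := Real.exp_pos (3 * p * t)
    nlinarith
  have hexp : Real.exp (3 * p) ≤ 36 / 25 := by
    have h1 : Real.exp (3 * p) ≤ Real.exp (63 / 200) := Real.exp_le_exp.2 (by linarith)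
    have h2 : (1 - 63 / 200 / 2 : ℝ) ≤ Real.exp (-(63 / 200 / 2)) := by
      linarith [Real.add_one_le_exp (-(63 / 200 / 2) : ℝ)]
    have h3 : Real.exp (63 / 200) * (Real.exp (-(63 / 200 / 2)) * Real.exp (-(63 / 200 / 2))) = 1 := by
      rw [← Real.exp_add, ← Real.exp_add]; norm_num
    have h4 : (1 - 63 / 200 / 2 : ℝ) ^ 2 ≤ Real.exp (-(63 / 200 / 2)) * Real.exp (-(63 / 200 / 2)) := by
      nlinarith
    have h5 := mul_le_mul_of_nonneg_left h4 (Real.exp_pos (63 / 200)).le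
    rw [h3] at h5
    norm_num at h5
    linarith
  set q := √(b 1) with hq
  have hqpos : 0 < q := Real.sqrt_pos.2 hb1
  have hq2 : q ^ 2 = b 1 := Real.sq_sqrt hb1.le
  have hbt : ∀ t ∈ Icc (0 : ℝ) 1, b t ≤ (6 / 5 * q) ^ 2 := by
    intro t ht
    by_contra! hlt
    have h := hmb ht ho ht.2
    simp only [mul_one] at h
    have h1 : 1 ≤ Real.exp (3 * p * t) := Real.one_le_exp (by have := ht.1; positivity)
    nlinarith
  set L := 3 * p ^ 2 * (6 / 5 * q) with hL
  have hc2 : ∀ t ∈ Icc (0 : ℝ) 1, c 1 - L * (1 - t) ≤ c t := by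
    have hmc : MonotoneOn (fun t => L * t - c t) (Icc 0 1) := by
      refine monotoneOn_Icc_of_hasDerivAt_nonneg
        (fun t ht => ((hasDerivAt_id t).const_mul L).sub (hc t ht)) (fun t ht => ?_)
      have := (abs_le.1 (hc' _ (by positivity : 0 < 6 / 5 * q) t ht (hbt t ht))).2
      simp only [mul_one]
      linarith
    intro t ht
    have h := hmc ht ho ht.2
    simp only at h
    linarith
  have hmm : MonotoneOn (fun t => m t - (c 1 * t - L * (t - t ^ 2 / 2))) (Icc 0 1) := by
    refine monotoneOn_Icc_of_hasDerivAt_nonneg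
      (fun t ht => (hm t ht).sub (((hasDerivAt_id t).const_mul (c 1)).sub
        (((hasDerivAt_id t).sub (((hasDerivAt_id t).pow 2).div_const 2)).const_mul L)))
      (fun t ht => ?_)
    have := hc2 t ht
    simp
    linarith
  have h := hmm hz ho zero_le_one
  norm_num at h
  linarith

/-- Polarization bound for a symmetric trilinear form controlled on the diagonal. -/
lemma trilinear_mixed_bound {E : Type*} [AddCommGroup E] [Module ℝ E]
    (T : E →ₗ[ℝ] E →ₗ[ℝ] E →ₗ[ℝ] ℝ) (B : E →ₗ[ℝ] E →ₗ[ℝ] ℝ)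
    (hT1 : ∀ u v w, T u v w = T v u w) (hT2 : ∀ u v w, T u v w = T u w v)
    (hB : ∀ u v, B u v = B v u) (hB0 : ∀ v, 0 ≤ B v v)
    (hTB : ∀ v, |T v v v| ≤ 2 * (B v v * √(B v v)))
    {u v : E} {p q : ℝ} (hp : 0 < p) (hq : 0 < q) (hu : B u u ≤ p ^ 2) (hv : B v v ≤ q ^ 2) :
    |T u v v| ≤ 3 * p * q ^ 2 := by
  have key : ∀ u v : E, B u u ≤ 1 → B v v ≤ 1 → |T u v v| ≤ 3 := by
    intro u v hu hv
    have e1 : B (u + (2 : ℝ) • v) (u + (2 : ℝ) • v) = B u u + 4 * B u v + 4 * B v v := by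
      simp [hB v u]; ring
    have e2 : B (u - (2 : ℝ) • v) (u - (2 : ℝ) • v) = B u u - 4 * B u v + 4 * B v v := by
      simp [hB v u]; ring
    have e3 : B (u + v) (u + v) = B u u + 2 * B u v + B v v := by
      simp [hB v u]; ring
    have e4 : B (u - v) (u - v) = B u u - 2 * B u v + B v v := by
      simp [hB v u]; ring
    have p3 := hB0 (u + v)
    have p4 := hB0 (u - v)
    have small : ∀ w : E, ∀ k : ℝ, 0 ≤ k → B w w ≤ k ^ 2 → |T w w w| ≤ 2 * k * B w w := by
      intro w k hk hw
      refine (hTB w).trans ?_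
      have : √(B w w) ≤ k := Real.sqrt_le_iff.2 ⟨hk, hw⟩
      nlinarith [mul_le_mul_of_nonneg_left this (hB0 w)]
    have s1 := small (u + (2 : ℝ) • v) 3 (by norm_num) (by rw [e1]; linarith)
    have s2 := small (u - (2 : ℝ) • v) 3 (by norm_num) (by rw [e2]; linarith)
    have s3 := small u 1 (by norm_num) (by linarith)
    have i1 : T (u + (2 : ℝ) • v) (u + (2 : ℝ) • v) (u + (2 : ℝ) • v)
        + T (u - (2 : ℝ) • v) (u - (2 : ℝ) • v) (u - (2 : ℝ) • v)
        = 24 * T u v v + 2 * T u u u := by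
      have a1 : T v u v = T u v v := hT1 v u v
      have a2 : T v v u = T u v v := by rw [hT2 v v u, hT1]
      simp [a1, a2]; ring
    rw [e1] at s1
    rw [e2] at s2
    rw [abs_le] at *
    constructor <;> linarith [s1.1, s1.2, s2.1, s2.2, s3.1, s3.2]
  have h := key (p⁻¹ • u) (q⁻¹ • v) (by
      simp only [map_smul, LinearMap.smul_apply, smul_eq_mul]
      rw [← mul_assoc, ← mul_inv, inv_mul_le_iff₀ (by positivity)]; nlinarith) (by
      simp only [map_smul, LinearMap.smul_apply, smul_eq_mul]
      rw [← mul_assoc, ← mul_inv, inv_mul_le_iff₀ (by positivity)]; nlinarith)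
  simp only [map_smul, LinearMap.smul_apply, smul_eq_mul] at h
  rw [← mul_assoc, ← mul_assoc, abs_mul, abs_of_pos (by positivity)] at h
  have h2 := mul_le_mul_of_nonneg_left h (by positivity : 0 ≤ p * q ^ 2)
  calc |T u v v| = p * q ^ 2 * (q⁻¹ * q⁻¹ * p⁻¹ * |T u v v|) := by field_simp
    _ ≤ p * q ^ 2 * 3 := h2
    _ = 3 * p * q ^ 2 := by ring

/-- The maximizer of the bounding function lies below `0.095`. -/
lemma maximizer_le {rstar : ℝ} (hmem : rstar ∈ Icc (0 : ℝ) (1 - 1 / √2))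
    (hmax : IsMaxOn
      (fun t : ℝ => (1 - t) * (1 - 7 * t + 3 * t ^ 2) * t / (1 - 4 * t + 2 * t ^ 2))
      (Icc (0 : ℝ) (1 - 1 / √2)) rstar) : rstar ≤ 19 / 200 := by
  have hs : √2 ^ 2 = 2 := Real.sq_sqrt (by norm_num)
  have hs0 : 0 < √2 := by positivity
  have hs1 : 1 / √2 = √2 / 2 := by field_simp; linarith
  have hs2 : √2 < 1.415 := by rw [Real.sqrt_lt' (by norm_num)]; norm_num
  rw [hs1] at hmem hmax
  obtain ⟨h0, h1⟩ := hmem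
  have hx : (0.0876 : ℝ) ∈ Icc (0 : ℝ) (1 - √2 / 2) := ⟨by norm_num, by linarith⟩
  have hm := hmax hx
  simp only [mem_ofPred_eq] at hm
  by_contra! hlt
  have hden : 0 ≤ 1 - 4 * rstar + 2 * rstar ^ 2 := by nlinarith
  rcases hden.eq_or_lt with hd | hd
  · rw [← hd, div_zero] at hm
    norm_num at hm
  · rw [le_div_iff₀ hd] at hm
    norm_num at hm
    have h2 : rstar < 0.2929 := by nlinarith [Real.lt_sqrt_of_sq_lt (by norm_num : (1.4142 : ℝ) ^ 2 < 2)]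
    nlinarith [mul_pos (sub_pos.2 hlt) (sub_pos.2 h2), mul_nonneg h0 (mul_pos (sub_pos.2 hlt) (sub_pos.2 h2)).le, mul_nonneg (sq_nonneg rstar) (mul_pos (sub_pos.2 hlt) (sub_pos.2 h2)).le]

lemma half_le_ratio {r : ℝ} (h0 : 0 ≤ r) (h1 : r ≤ 19 / 200) :
    1 / 2 ≤ (1 - r) * (1 - 7 * r + 3 * r ^ 2) / (1 - 4 * r + 2 * r ^ 2) := by
  rw [le_div_iff₀ (by nlinarith)]
  nlinarith [mul_nonneg h0 (sub_nonneg.2 h1), mul_nonneg (sq_nonneg r) (sub_nonneg.2 h1)]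

lemma ratio_le_lower_bound {r : ℝ} (h0 : 0 ≤ r) (h1 : r ≤ 19 / 200) :
    (1 - r) * (1 - 7 * r + 3 * r ^ 2) * r / (1 - 4 * r + 2 * r ^ 2) ≤
      r / (1 + r) - 9 / 5 * (r / (1 - r)) ^ 2 := by
  have hd : 0 < 1 - 4 * r + 2 * r ^ 2 := by nlinarith
  have hA : r * (1 - r) ≤ r / (1 + r) := by
    rw [le_div_iff₀ (by linarith)]; nlinarith [mul_nonneg h0 (sq_nonneg r)]
  have hB : (r / (1 - r)) ^ 2 ≤ 1.23 * r ^ 2 := by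
    rw [div_pow, div_le_iff₀ (by nlinarith)]
    nlinarith [mul_nonneg (sq_nonneg r) (by nlinarith : 0 ≤ 1.23 * (1 - r) ^ 2 - 1)]
  have hC : (1 - r) * (1 - 7 * r + 3 * r ^ 2) * r / (1 - 4 * r + 2 * r ^ 2)
      ≤ r * (1 - 3.22 * r) := by
    rw [div_le_iff₀ hd]
    have : (1 - r) * (1 - 7 * r + 3 * r ^ 2) ≤ (1 - 3.22 * r) * (1 - 4 * r + 2 * r ^ 2) := by
      nlinarith [mul_nonneg h0 (sub_nonneg.2 h1), mul_nonneg (sq_nonneg r) (sub_nonneg.2 h1)]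
    nlinarith [mul_le_mul_of_nonneg_left this h0]
  nlinarith

lemma nonneg_of_hasDerivAt_of_eventually_le {φ : ℝ → ℝ} {d s : ℝ} (hφ : HasDerivAt φ d 0)
    (h : ∀ᶠ t in 𝓝[>] (0 : ℝ), φ 0 ≤ φ t + t * s) : 0 ≤ d + s := by
  have h1 := (hφ.tendsto_slope_zero_right).add_const s
  refine ge_of_tendsto h1 ?_
  filter_upwards [h, self_mem_nhdsWithin] with t ht htp
  have htp : 0 < t := htp
  simp only [zero_add, smul_eq_mul]
  have : t⁻¹ * (φ t - φ 0) + s = t⁻¹ * (φ t + t * s - φ 0) := by field_simp; ring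
  rw [this]
  exact mul_nonneg (by positivity) (by linarith)

lemma EConvex.le_segment {n : ℕ} {g : (Fin n → ℝ) → EReal} (hg : EConvex g) {x y : Fin n → ℝ} {a b : ℝ}
    (hx : g x = a) (hy : g y = b) {t : ℝ} (ht0 : 0 ≤ t) (ht1 : t ≤ 1) :
    g (x + t • (y - x)) ≤ ((a + t * (b - a) : ℝ) : EReal) := by
  have h := hg x y (1 - t) t (by linarith) ht0 (by ring)
  rw [hx, hy, ← EReal.coe_mul, ← EReal.coe_mul, ← EReal.coe_add] at h
  have e1 : (1 - t) • x + t • y = x + t • (y - x) := by module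
  have e2 : (1 - t) * a + t * b = a + t * (b - a) := by ring
  rwa [e1, e2] at h

lemma eventually_small : ∀ᶠ t in 𝓝[>] (0 : ℝ), 0 < t ∧ t < 1 := by
  have := Ioo_mem_nhdsGT (zero_lt_one : (0 : ℝ) < 1)
  exact this

/-- First-order optimality condition for the composite minimizer. -/
lemma composite_optimality {n : ℕ} {D : Set (Fin n → ℝ)} {f : (Fin n → ℝ) → ℝ} {v : Fin n → ℝ}
    {g : (Fin n → ℝ) → EReal} (hD : IsOpen D) {xs : Fin n → ℝ} (hxs : xs ∈ D)
    (hgrad : HasFDerivAt f (dotCLM v) xs) (hg : EConvex g)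
    (hmin : ∀ y, Fext D f g xs ≤ Fext D f g y) {p : Fin n → ℝ} {a b : ℝ}
    (ha : g xs = a) (hb : g p = b) : 0 ≤ v ⬝ᵥ (p - xs) + (b - a) := by
  have hline : HasDerivAt (fun t : ℝ => xs + t • (p - xs)) (p - xs) 0 := by
    simpa using ((hasDerivAt_id (0 : ℝ)).smul_const (p - xs)).const_add xs
  have hφ : HasDerivAt (fun t : ℝ => f (xs + t • (p - xs))) (v ⬝ᵥ (p - xs)) 0 :=
    HasFDerivAt.comp_hasDerivAt (l := f) (l' := dotCLM v) (0 : ℝ) (by simpa using hgrad) hline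
  refine nonneg_of_hasDerivAt_of_eventually_le hφ ?_
  have hmem : ∀ᶠ t in 𝓝[>] (0 : ℝ), xs + t • (p - xs) ∈ D :=
    (hline.continuousAt.eventually (by simpa using hD.mem_nhds hxs)).filter_mono nhdsWithin_le_nhds
  filter_upwards [hmem, eventually_small] with t htD ht
  have h1 := hmin (xs + t • (p - xs))
  rw [Fext, Fext, if_pos hxs, if_pos htD, ha] at h1
  have h2 := h1.trans (add_le_add le_rfl (hg.le_segment ha hb ht.1.le ht.2.le))
  rw [← EReal.coe_add, ← EReal.coe_add, EReal.coe_le_coe_iff] at h2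
  simp only [zero_smul, add_zero]
  linarith

lemma dotProduct_mulVec_symm {n : ℕ} {H : Matrix (Fin n) (Fin n) ℝ} (hH : H.PosDef)
    (x y : Fin n → ℝ) : x ⬝ᵥ H.mulVec y = y ⬝ᵥ H.mulVec x := by
  have hT : Hᵀ = H := by
    have := hH.1
    rwa [Matrix.IsHermitian, Matrix.conjTranspose_eq_transpose_of_trivial] at this
  rw [dotProduct_comm, dotProduct_mulVec, ← Matrix.mulVec_transpose, hT]

/-- First-order optimality condition for the proximal subproblem. -/
lemma prox_optimality {n : ℕ} {H : Matrix (Fin n) (Fin n) ℝ} (hH : H.PosDef)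
    {g : (Fin n → ℝ) → EReal} (hg : EConvex g) {u p y : Fin n → ℝ} (hp : IsProxPt H g u p)
    {a b : ℝ} (ha : g p = a) (hb : g y = b) :
    0 ≤ (H.mulVec p - u) ⬝ᵥ (y - p) + (b - a) := by
  set w := y - p with hw
  have hpoly : ∀ t : ℝ, 1 / 2 * ((p + t • w) ⬝ᵥ H.mulVec (p + t • w)) - u ⬝ᵥ (p + t • w) =
      (1 / 2 * (p ⬝ᵥ H.mulVec p) - u ⬝ᵥ p) + t * ((H.mulVec p - u) ⬝ᵥ w)
        + t ^ 2 * (1 / 2 * (w ⬝ᵥ H.mulVec w)) := by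
    intro t
    have h1 := dotProduct_mulVec_symm hH p w
    simp only [mulVec_add, mulVec_smul, dotProduct_add, add_dotProduct, smul_dotProduct,
      dotProduct_smul, sub_dotProduct, smul_eq_mul, h1, dotProduct_comm (H.mulVec p) w]
    ring
  have hφ : HasDerivAt (fun t : ℝ => t * ((H.mulVec p - u) ⬝ᵥ w)
        + t ^ 2 * (1 / 2 * (w ⬝ᵥ H.mulVec w))) ((H.mulVec p - u) ⬝ᵥ w) 0 := by
    exact (((hasDerivAt_id (0 : ℝ)).mul_const ((H.mulVec p - u) ⬝ᵥ w)).add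
      (((hasDerivAt_id (0 : ℝ)).pow 2).mul_const (1 / 2 * (w ⬝ᵥ H.mulVec w)))).congr_deriv
        (by simp)
  refine nonneg_of_hasDerivAt_of_eventually_le hφ ?_
  filter_upwards [eventually_small] with t ht
  have h1 := hp (p + t • w)
  rw [proxObj, proxObj, ha] at h1
  have h2 := h1.trans (add_le_add (hg.le_segment ha hb ht.1.le ht.2.le) le_rfl)
  rw [← EReal.coe_add, ← EReal.coe_add, EReal.coe_le_coe_iff, hpoly] at h2
  linarith

/-- Monotonicity inequality linking the minimizer and the proximal-Newton point. -/
lemma newton_monotonicity {n : ℕ} {D : Set (Fin n → ℝ)} {f : (Fin n → ℝ) → ℝ}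
    {vs vk : Fin n → ℝ} {g : (Fin n → ℝ) → EReal} (hD : IsOpen D) {xs : Fin n → ℝ} (hxs : xs ∈ D)
    (hgrad : HasFDerivAt f (dotCLM vs) xs) (hgp : EProper g) (hg : EConvex g)
    (hmin : ∀ y, Fext D f g xs ≤ Fext D f g y) (hgs : g xs ≠ ⊤)
    {H : Matrix (Fin n) (Fin n) ℝ} (hH : H.PosDef) {xk d : Fin n → ℝ}
    (hd : IsProxPt H g (H.mulVec xk - vk) (xk + d)) :
    (vk - vs + H.mulVec d) ⬝ᵥ (xk - xs + d) ≤ 0 := by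
  have hgk : g (xk + d) ≠ ⊤ := by
    intro htop
    have h := hd xs
    rw [proxObj, htop, EReal.top_add_coe, top_le_iff, proxObj] at h
    lift g xs to ℝ using ⟨hgs, hgp.1 xs⟩ with a
    exact EReal.coe_ne_top _ h
  have ha := (EReal.coe_toReal hgs (hgp.1 xs)).symm
  have hb := (EReal.coe_toReal hgk (hgp.1 (xk + d))).symm
  have h1 := composite_optimality hD hxs hgrad hg hmin ha hb
  have h2 := prox_optimality hH hg hd hb ha
  have e1 : xk + d - xs = xk - xs + d := by abel
  have e2 : xs - (xk + d) = -(xk - xs + d) := by abel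
  have e3 : H.mulVec (xk + d) - (H.mulVec xk - vk) = H.mulVec d + vk := by
    rw [mulVec_add]; abel
  rw [e1] at h1
  rw [e2, e3, dotProduct_neg] at h2
  have e4 : vk - vs + H.mulVec d = H.mulVec d + vk - vs := by abel
  rw [e4, sub_dotProduct]
  linarith

lemma dotCLM_apply {n : ℕ} (v y : Fin n → ℝ) : dotCLM v y = v ⬝ᵥ y := rfl

section Smoothness

variable {n : ℕ} {D : Set (Fin n → ℝ)} {f : (Fin n → ℝ) → ℝ} {f' : (Fin n → ℝ) → Fin n → ℝ}

lemma contDiffOn_gradient (hD : IsOpen D) (hf : ContDiffOn ℝ 3 f D)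
    (hgrad : ∀ x ∈ D, HasFDerivAt f (dotCLM (f' x)) x) : ContDiffOn ℝ 2 f' D := by
  rw [contDiffOn_pi]
  intro i
  have h1 : ContDiffOn ℝ 2 (fderiv ℝ f) D := hf.fderiv_of_isOpen hD (by norm_num)
  refine (h1.clm_apply (contDiffOn_const (c := Pi.single i (1 : ℝ)))).congr (fun x hx => ?_)
  rw [(hgrad x hx).fderiv, dotCLM_apply, dotProduct_single, mul_one]

/-- The bilinear form `(v, w) ↦ vᵀ ∇²f(x) w`. -/
def hessForm (f' : (Fin n → ℝ) → Fin n → ℝ) (x : Fin n → ℝ) :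
    (Fin n → ℝ) →ₗ[ℝ] (Fin n → ℝ) →ₗ[ℝ] ℝ :=
  LinearMap.mk₂ ℝ (fun v w => v ⬝ᵥ fderiv ℝ f' x w)
    (fun a b c => add_dotProduct _ _ _) (fun a b c => smul_dotProduct _ _ _)
    (fun a b c => by rw [map_add, dotProduct_add]) (fun a b c => by rw [map_smul, dotProduct_smul])

lemma hessForm_apply (x v w : Fin n → ℝ) : hessForm f' x v w = v ⬝ᵥ fderiv ℝ f' x w := rfl

/-- The trilinear form given by the third derivative of `f`. -/
def thirdForm (f' : (Fin n → ℝ) → Fin n → ℝ) (x : Fin n → ℝ) :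
    (Fin n → ℝ) →ₗ[ℝ] (Fin n → ℝ) →ₗ[ℝ] (Fin n → ℝ) →ₗ[ℝ] ℝ where
  toFun u := LinearMap.mk₂ ℝ (fun v w => v ⬝ᵥ fderiv ℝ (fderiv ℝ f') x u w)
    (fun a b c => add_dotProduct _ _ _) (fun a b c => smul_dotProduct _ _ _)
    (fun a b c => by rw [map_add, dotProduct_add]) (fun a b c => by rw [map_smul, dotProduct_smul])
  map_add' a b := by ext v w; simp
  map_smul' a b := by ext v w; simp

lemma thirdForm_apply (x u v w : Fin n → ℝ) :
    thirdForm f' x u v w = v ⬝ᵥ fderiv ℝ (fderiv ℝ f') x u w := rfl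

lemma hasDerivAt_line (x v : Fin n → ℝ) (t : ℝ) :
    HasDerivAt (fun s : ℝ => x + s • v) v t := by
  simpa using ((hasDerivAt_id t).smul_const v).const_add x

lemma HasDerivAt.const_dotProduct {γ : ℝ → Fin n → ℝ} {γ' : Fin n → ℝ} {t : ℝ} (w : Fin n → ℝ)
    (h : HasDerivAt γ γ' t) : HasDerivAt (fun s => w ⬝ᵥ γ s) (w ⬝ᵥ γ') t :=
  (dotCLM w).hasFDerivAt.comp_hasDerivAt t h

lemma hasDerivAt_gradient_line (hD : IsOpen D) (hf' : ContDiffOn ℝ 2 f' D) {x e : Fin n → ℝ} {t : ℝ}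
    (ht : x + t • e ∈ D) (v : Fin n → ℝ) :
    HasDerivAt (fun s : ℝ => v ⬝ᵥ f' (x + s • e)) (hessForm f' (x + t • e) v e) t :=
  HasDerivAt.const_dotProduct v <| HasFDerivAt.comp_hasDerivAt (l := f') t
    ((hf'.contDiffAt (hD.mem_nhds ht)).differentiableAt (by norm_num)).hasFDerivAt
    (hasDerivAt_line x e t)

lemma hasDerivAt_hessForm_line (hD : IsOpen D) (hf' : ContDiffOn ℝ 2 f' D) {x e : Fin n → ℝ} {t : ℝ}
    (ht : x + t • e ∈ D) (v w : Fin n → ℝ) :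
    HasDerivAt (fun s : ℝ => hessForm f' (x + s • e) v w) (thirdForm f' (x + t • e) e v w) t := by
  have h1 : ContDiffOn ℝ 1 (fderiv ℝ f') D := hf'.fderiv_of_isOpen hD (by norm_num)
  have h2 := HasFDerivAt.comp_hasDerivAt (l := fderiv ℝ f') t
    ((h1.contDiffAt (hD.mem_nhds ht)).differentiableAt (by norm_num)).hasFDerivAt
    (hasDerivAt_line x e t)
  exact HasDerivAt.const_dotProduct v
    (by simpa using HasDerivAt.clm_apply h2 (hasDerivAt_const t w))

lemma hessForm_symm (hD : IsOpen D) (hf : ContDiffOn ℝ 3 f D)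
    (hgrad : ∀ x ∈ D, HasFDerivAt f (dotCLM (f' x)) x) {x : Fin n → ℝ} (hx : x ∈ D)
    (v w : Fin n → ℝ) : hessForm f' x v w = hessForm f' x w v := by
  have hf' := contDiffOn_gradient hD hf hgrad
  have hs := (hf.contDiffAt (hD.mem_nhds hx)).isSymmSndFDerivAt
    (by rw [minSmoothness_of_isRCLikeNormedField]; norm_num)
  have key : ∀ v w : Fin n → ℝ, fderiv ℝ (fderiv ℝ f) x w v = hessForm f' x v w := by
    intro v w
    have h1 : ContDiffOn ℝ 2 (fderiv ℝ f) D := hf.fderiv_of_isOpen hD (by norm_num)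
    have hx0 : x + (0 : ℝ) • w ∈ D := by simpa using hx
    have h2 := HasFDerivAt.comp_hasDerivAt (l := fderiv ℝ f) 0
      ((h1.contDiffAt (hD.mem_nhds hx0)).differentiableAt (by norm_num)).hasFDerivAt
      (hasDerivAt_line x w 0)
    have h3 := HasDerivAt.clm_apply h2 (hasDerivAt_const 0 v)
    simp only [map_zero, add_zero, Function.comp_apply] at h3
    have h4 := hasDerivAt_gradient_line hD hf' hx0 v
    have h5 : (fun s : ℝ => v ⬝ᵥ f' (x + s • w)) =ᶠ[𝓝 0]
        fun s => fderiv ℝ f (x + s • w) v := by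
      filter_upwards [(hasDerivAt_line x w 0).continuousAt.eventually (hD.mem_nhds hx0)] with s hs
      rw [(hgrad _ hs).fderiv, dotCLM_apply, dotProduct_comm]
    simpa using h3.unique (h4.congr_of_eventuallyEq h5.symm)
  rw [← key, ← key]
  exact hs w v

lemma thirdForm_symm_last (hD : IsOpen D) (hf : ContDiffOn ℝ 3 f D)
    (hgrad : ∀ x ∈ D, HasFDerivAt f (dotCLM (f' x)) x) {x : Fin n → ℝ} (hx : x ∈ D)
    (u v w : Fin n → ℝ) : thirdForm f' x u v w = thirdForm f' x u w v := by
  have hf' := contDiffOn_gradient hD hf hgrad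
  have hx0 : x + (0 : ℝ) • u ∈ D := by simpa using hx
  have h5 : (fun s : ℝ => hessForm f' (x + s • u) v w) =ᶠ[𝓝 0]
      fun s => hessForm f' (x + s • u) w v := by
    filter_upwards [(hasDerivAt_line x u 0).continuousAt.eventually (hD.mem_nhds hx0)] with s hs
    exact hessForm_symm hD hf hgrad hs v w
  simpa using (hasDerivAt_hessForm_line hD hf' hx0 v w).unique
    ((hasDerivAt_hessForm_line hD hf' hx0 w v).congr_of_eventuallyEq h5)

lemma thirdForm_symm_first (hD : IsOpen D) (hf : ContDiffOn ℝ 3 f D)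
    (hgrad : ∀ x ∈ D, HasFDerivAt f (dotCLM (f' x)) x) {x : Fin n → ℝ} (hx : x ∈ D)
    (u v w : Fin n → ℝ) : thirdForm f' x u v w = thirdForm f' x v u w := by
  have hs := ((contDiffOn_gradient hD hf hgrad).contDiffAt (hD.mem_nhds hx)).isSymmSndFDerivAt
    (by simp)
  have h1 : ∀ a b c : Fin n → ℝ, thirdForm f' x a b c = thirdForm f' x c b a := fun a b c => by
    rw [thirdForm_apply, thirdForm_apply, hs a c]
  rw [thirdForm_symm_last hD hf hgrad hx, h1, thirdForm_symm_last hD hf hgrad hx]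

lemma hessForm_nonneg (hD : IsOpen D) (hconv : ConvexOn ℝ D f) (hf : ContDiffOn ℝ 3 f D)
    (hgrad : ∀ x ∈ D, HasFDerivAt f (dotCLM (f' x)) x) {x : Fin n → ℝ} (hx : x ∈ D)
    (v : Fin n → ℝ) : 0 ≤ hessForm f' x v v := by
  have hf' := contDiffOn_gradient hD hf hgrad
  have hx0 : x + (0 : ℝ) • v ∈ D := by simpa using hx
  set S : Set ℝ := (fun s : ℝ => x + s • v) ⁻¹' D with hS
  have hSo : IsOpen S := hD.preimage (by fun_prop)
  have hc : ConvexOn ℝ S (fun s : ℝ => f (x + s • v)) := by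
    have := hconv.comp_affineMap (AffineMap.lineMap x (x + v))
    have e : (AffineMap.lineMap x (x + v) : ℝ → Fin n → ℝ) = fun s : ℝ => x + s • v := by
      ext1 s; simp [AffineMap.lineMap_apply, add_comm]
    rw [e] at this
    exact this
  have hder : ∀ s ∈ S, HasDerivAt (fun s : ℝ => f (x + s • v)) (v ⬝ᵥ f' (x + s • v)) s := by
    intro s hs
    have := HasFDerivAt.comp_hasDerivAt (l := f) s (hgrad _ hs) (hasDerivAt_line x v s)
    rwa [dotCLM_apply, dotProduct_comm] at this
  have hmono := hc.monotoneOn_deriv (fun s hs => (hder s hs).differentiableAt)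
  have h2 := hasDerivAt_gradient_line hD hf' hx0 v
  have h3 := h2.tendsto_slope_zero_right
  simp only [zero_smul, add_zero, zero_add] at h3
  refine ge_of_tendsto h3 ?_
  filter_upwards [nhdsWithin_le_nhds (hSo.mem_nhds hx0), self_mem_nhdsWithin] with s hs hs0
  have hs0 : 0 < s := hs0
  have h4 := hmono hx0 hs hs0.le
  rw [(hder 0 hx0).deriv, (hder s hs).deriv] at h4
  simp only [zero_smul, add_zero] at h4
  exact mul_nonneg (by positivity) (by linarith)

lemma abs_thirdForm_diag_le (hsc : StdSelfConcordantOn D f)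
    (hgrad : ∀ x ∈ D, HasFDerivAt f (dotCLM (f' x)) x) {x : Fin n → ℝ} (hx : x ∈ D)
    (v : Fin n → ℝ) :
    |thirdForm f' x v v v| ≤ 2 * (hessForm f' x v v * √(hessForm f' x v v)) := by
  obtain ⟨hD, -, hconv, hf, h3⟩ := hsc
  have hf' := contDiffOn_gradient hD hf hgrad
  have hx0 : x + (0 : ℝ) • v ∈ D := by simpa using hx
  have hSo : IsOpen ((fun s : ℝ => x + s • v) ⁻¹' D) := hD.preimage (by fun_prop)
  have d1 : ∀ s : ℝ, x + s • v ∈ D →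
      deriv (fun s : ℝ => f (x + s • v)) s = v ⬝ᵥ f' (x + s • v) := by
    intro s hs
    have := HasFDerivAt.comp_hasDerivAt (l := f) s (hgrad _ hs) (hasDerivAt_line x v s)
    rw [dotCLM_apply, dotProduct_comm] at this
    exact this.deriv
  have d2 : ∀ s : ℝ, x + s • v ∈ D →
      iteratedDeriv 2 (fun s : ℝ => f (x + s • v)) s = hessForm f' (x + s • v) v v := by
    intro s hs
    rw [iteratedDeriv_succ, iteratedDeriv_one]
    have he : deriv (fun s : ℝ => f (x + s • v)) =ᶠ[𝓝 s] fun s => v ⬝ᵥ f' (x + s • v) := by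
      filter_upwards [hSo.mem_nhds hs] with y hy using d1 y hy
    rw [he.deriv_eq, (hasDerivAt_gradient_line hD hf' hs v).deriv]
  have d3 : iteratedDeriv 3 (fun s : ℝ => f (x + s • v)) 0 = thirdForm f' x v v v := by
    rw [iteratedDeriv_succ]
    have he : iteratedDeriv 2 (fun s : ℝ => f (x + s • v)) =ᶠ[𝓝 0]
        fun s => hessForm f' (x + s • v) v v := by
      filter_upwards [hSo.mem_nhds hx0] with y hy using d2 y hy
    rw [he.deriv_eq, (hasDerivAt_hessForm_line hD hf' hx0 v v).deriv, zero_smul, add_zero]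
  have h := h3 x hx v 0 hx0
  rw [d3, d2 0 hx0, zero_smul, add_zero] at h
  have hn := hessForm_nonneg hD hconv hf hgrad hx v
  rwa [show (3 : ℝ) / 2 = 1 + 1 / 2 by norm_num, Real.rpow_add_of_nonneg hn (by norm_num)
    (by norm_num), Real.rpow_one, ← Real.sqrt_eq_rpow] at h

end Smoothness

/-- The Newton decrement is bounded below by the local distance to the minimizer, up to a
quadratic term. -/
lemma decrement_lower_bound {n : ℕ} {D : Set (Fin n → ℝ)} {f : (Fin n → ℝ) → ℝ}
    {f' : (Fin n → ℝ) → Fin n → ℝ} (hsc : StdSelfConcordantOn D f)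
    (hgrad : ∀ x ∈ D, HasFDerivAt f (dotCLM (f' x)) x)
    {xs xk d : Fin n → ℝ} (hxs : xs ∈ D) (hxk : xk ∈ D) {r : ℝ}
    (hr : r = √(hessForm f' xs (xk - xs) (xk - xs))) (hr1 : r ≤ 19 / 200)
    (hmono : (f' xk - f' xs + fderiv ℝ f' xk d) ⬝ᵥ (xk - xs + d) ≤ 0) :
    r / (1 + r) - 9 / 5 * (r / (1 - r)) ^ 2 ≤ √(hessForm f' xk d d) := by
  have hr0 : 0 ≤ r := hr ▸ Real.sqrt_nonneg _
  rcases hr0.eq_or_lt with hr00 | hrpos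
  · rw [← hr00]; simp
  obtain ⟨hD, hDc, hconv, hf, -⟩ := id hsc
  have hf' := contDiffOn_gradient hD hf hgrad
  set e := xk - xs with he
  obtain ⟨h, hh⟩ : ∃ h, h = e + d := ⟨_, rfl⟩
  have hd : d = h - e := by rw [hh]; abel
  rw [← hh] at hmono
  have hseg : ∀ t ∈ Icc (0 : ℝ) 1, xs + t • e ∈ D := fun t ht =>
    hDc.add_smul_sub_mem hxs hxk ht
  have hx1 : xs + (1 : ℝ) • e = xk := by rw [he]; module
  have hx0 : xs + (0 : ℝ) • e = xs := by module
  have hB0 : ∀ t ∈ Icc (0 : ℝ) 1, ∀ v, 0 ≤ hessForm f' (xs + t • e) v v :=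
    fun t ht => hessForm_nonneg hD hconv hf hgrad (hseg t ht)
  have hsymm : ∀ v w, hessForm f' xk v w = hessForm f' xk w v := hessForm_symm hD hf hgrad hxk
  have hmixed : ∀ t ∈ Icc (0 : ℝ) 1, ∀ (u v : Fin n → ℝ) (p q : ℝ), 0 < p → 0 < q →
      hessForm f' (xs + t • e) u u ≤ p ^ 2 → hessForm f' (xs + t • e) v v ≤ q ^ 2 →
      |thirdForm f' (xs + t • e) u v v| ≤ 3 * p * q ^ 2 := fun t ht u v p q hp hq hu hv =>
    trilinear_mixed_bound _ _ (thirdForm_symm_first hD hf hgrad (hseg t ht))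
      (thirdForm_symm_last hD hf hgrad (hseg t ht)) (hessForm_symm hD hf hgrad (hseg t ht))
      (hB0 t ht) (abs_thirdForm_diag_le hsc hgrad (hseg t ht)) hp hq hu hv
  have ha0 : √(hessForm f' (xs + (0 : ℝ) • e) e e) = r := by rw [hx0, hr]
  obtain ⟨hup, hlow⟩ := sqrt_bounds_of_selfConcordant
    (a := fun t => hessForm f' (xs + t • e) e e)
    (fun t ht => hasDerivAt_hessForm_line hD hf' (hseg t ht) e e) (fun t ht => hB0 t ht e)
    (fun t ht => abs_thirdForm_diag_le hsc hgrad (hseg t ht) e)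
    (Real.sqrt_pos.1 (ha0 ▸ hrpos)) (by simp only [ha0]; linarith)
  simp only [ha0, hx1] at hup hlow
  set p := r / (1 - r) with hp
  have hppos : 0 < p := div_pos hrpos (by linarith)
  have hp1 : p ≤ 21 / 200 := by rw [hp, div_le_iff₀ (by linarith)]; linarith
  have hap : ∀ t ∈ Icc (0 : ℝ) 1, hessForm f' (xs + t • e) e e ≤ p ^ 2 :=
    fun t ht => (Real.sqrt_le_left hppos.le).1 (hup t ht)
  set ρ := √(hessForm f' xk e e) with hρ
  have hρpos : 0 < ρ := lt_of_lt_of_le (div_pos hrpos (by linarith)) hlow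
  have hρ2 : ρ ^ 2 = hessForm f' xk e e :=
    Real.sq_sqrt (hessForm_nonneg hD hconv hf hgrad hxk e)
  have hbn := hessForm_nonneg hD hconv hf hgrad hxk h
  set q := √(hessForm f' xk h h) with hq
  have hq2 : q ^ 2 = hessForm f' xk h h := Real.sq_sqrt hbn
  have hqn : 0 ≤ q := Real.sqrt_nonneg _
  have hCS : hessForm f' xk h e ≤ q * ρ := by
    rcases hqn.eq_or_lt with hq0 | hqpos
    · have h1 : ∀ s : ℝ, 0 ≤ ρ ^ 2 - 2 * s * hessForm f' xk h e := by
        intro s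
        have := hessForm_nonneg hD hconv hf hgrad hxk (e - s • h)
        simp [hsymm e h, ← hρ2, ← hq2, ← hq0] at this
        linarith
      by_contra! hlt
      rw [← hq0, zero_mul] at hlt
      have := h1 ((ρ ^ 2 + 1) / hessForm f' xk h e)
      have e1 : 2 * ((ρ ^ 2 + 1) / hessForm f' xk h e) * hessForm f' xk h e
          = 2 * (ρ ^ 2 + 1) := by field_simp
      rw [e1] at this
      nlinarith
    · have := hessForm_nonneg hD hconv hf hgrad hxk (q • e - ρ • h)
      simp [hsymm e h, ← hρ2, ← hq2] at this
      have h2 : 0 ≤ (q * ρ) * (q * ρ - hessForm f' xk h e) := by linarith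
      linarith [nonneg_of_mul_nonneg_right h2 (by positivity)]
  have hqle : q ≤ 9 / 5 * p ^ 2 := by
    rcases hqn.eq_or_lt with hq0 | hqpos
    · rw [← hq0]; positivity
    have hlin := linearization_error_le (b := fun t => hessForm f' (xs + t • e) h h)
      (c := fun t => hessForm f' (xs + t • e) h e) (m := fun t => h ⬝ᵥ f' (xs + t • e))
      hppos.le hp1
      (fun t ht => hasDerivAt_hessForm_line hD hf' (hseg t ht) h h)
      (fun t ht => hasDerivAt_hessForm_line hD hf' (hseg t ht) h e)
      (fun t ht => hasDerivAt_gradient_line hD hf' (hseg t ht) h)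
      (fun t ht => by
        refine le_of_forall_pos_le_add fun ε hε => ?_
        have hb := hB0 t ht h
        have hδ : 0 < ε / (3 * p) := by positivity
        have hs : √(hessForm f' (xs + t • e) h h + ε / (3 * p)) ^ 2
          = hessForm f' (xs + t • e) h h + ε / (3 * p) := Real.sq_sqrt (by linarith)
        have := hmixed t ht e h p _ hppos (Real.sqrt_pos.2 (add_pos_of_nonneg_of_pos hb hδ))
          (hap t ht) (by rw [hs]; linarith)
        rw [hs] at this
        refine this.trans (le_of_eq ?_)
        field_simp)
      (fun q' hq' t ht hbq => by
        rw [thirdForm_symm_first hD hf hgrad (hseg t ht)]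
        refine (hmixed t ht h e q' p hq' hppos hbq (hap t ht)).trans (le_of_eq (by ring)))
      (by rw [hx1]; exact Real.sqrt_pos.1 hqpos)
    simp only [hx1, hx0, ← hq] at hlin
    have e1 : (f' xk - f' xs + fderiv ℝ f' xk d) ⬝ᵥ h
        = h ⬝ᵥ f' xk - h ⬝ᵥ f' xs + (q ^ 2 - hessForm f' xk h e) := by
      rw [hq2, hessForm_apply, hessForm_apply, hd, dotProduct_comm, dotProduct_add,
        dotProduct_sub, map_sub, dotProduct_sub]
    rw [e1] at hmono
    nlinarith
  have hfin : (ρ - q) ^ 2 ≤ hessForm f' xk d d := by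
    rw [hd]
    simp [hsymm e h, ← hρ2, ← hq2]
    nlinarith
  have := (le_abs_self _).trans (Real.abs_le_sqrt hfin)
  linarith

/-- For a full-step proximal-Newton iterate with `r_k ≤ r*`, where `r*`
maximizes `s(r) = (1−r)(1−7r+3r²)r/(1−4r+2r²)`, one has `s(r_k) ≤ λ_k`,
`(1−r_k)(1−7r_k+3r_k²)/(1−4r_k+2r_k²) ≥ 1/2`, hence `r_k ≤ 2λ_k`; in particular `λ_k ≤ ε`
implies `‖x^k − x*‖_{x*} ≤ 2ε`. -/
theorem decrement_controls_distance
    (n : ℕ) (D : Set (Fin n → ℝ)) (f : (Fin n → ℝ) → ℝ)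
    (f' : (Fin n → ℝ) → Fin n → ℝ)
    (f'' : (Fin n → ℝ) → Matrix (Fin n) (Fin n) ℝ)
    (hf : StdSelfConcordantOn D f)
    (hgrad : ∀ x ∈ D, HasFDerivAt f (dotCLM (f' x)) x)
    (hhess : ∀ x ∈ D,
      HasFDerivAt f' (LinearMap.toContinuousLinearMap (f'' x).mulVecLin) x)
    (g : (Fin n → ℝ) → EReal) (hg_proper : EProper g)
    (hg_lsc : LowerSemicontinuous g) (hg_conv : EConvex g)
    (xs : Fin n → ℝ) (hxsD : xs ∈ D) (hxsg : g xs ≠ ⊤)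
    (hxs_min : ∀ y, Fext D f g xs ≤ Fext D f g y)
    (hxs_uniq : ∀ y, (∀ z, Fext D f g y ≤ Fext D f g z) → y = xs)
    (hxs_pd : (f'' xs).PosDef)
    (xk : Fin n → ℝ) (hxkD : xk ∈ D) (hxkg : g xk ≠ ⊤) (hpdk : (f'' xk).PosDef)
    (dk : Fin n → ℝ)
    (hdk : IsProxPt (f'' xk) g ((f'' xk).mulVec xk - f' xk) (xk + dk))
    (lamk : ℝ) (hlamk : lamk = mNorm (f'' xk) dk)
    (rk : ℝ) (hrk : rk = mNorm (f'' xs) (xk - xs))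
    (rstar : ℝ) (hrstar_mem : rstar ∈ Icc (0 : ℝ) (1 - 1 / Real.sqrt 2))
    (hrstar : IsMaxOn
      (fun t : ℝ => (1 - t) * (1 - 7 * t + 3 * t ^ 2) * t / (1 - 4 * t + 2 * t ^ 2))
      (Icc (0 : ℝ) (1 - 1 / Real.sqrt 2)) rstar)
    (hle : rk ≤ rstar) :
    (1 - rk) * (1 - 7 * rk + 3 * rk ^ 2) * rk / (1 - 4 * rk + 2 * rk ^ 2) ≤ lamk ∧
      1 / 2 ≤ (1 - rk) * (1 - 7 * rk + 3 * rk ^ 2) / (1 - 4 * rk + 2 * rk ^ 2) ∧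
      rk ≤ 2 * lamk ∧
      ∀ eps : ℝ, lamk ≤ eps → rk ≤ 2 * eps := by
  obtain ⟨hD, -, -, -, -⟩ := id hf
  have hrs : rk ≤ 19 / 200 := hle.trans (maximizer_le hrstar_mem hrstar)
  have hr0 : 0 ≤ rk := hrk ▸ Real.sqrt_nonneg _
  have hfd : ∀ x ∈ D, ∀ v, fderiv ℝ f' x v = (f'' x).mulVec v := fun x hx v => by
    rw [(hhess x hx).fderiv]; rfl
  have hmono := newton_monotonicity hD hxsD (hgrad xs hxsD) hg_proper hg_conv hxs_min hxsg hpdk hdk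
  rw [← hfd xk hxkD] at hmono
  have hlow := decrement_lower_bound hf hgrad hxsD hxkD
    (by rw [hrk, hessForm_apply, hfd xs hxsD]; rfl) hrs hmono
  have hlam : √(hessForm f' xk dk dk) = lamk := by
    rw [hlamk, hessForm_apply, hfd xk hxkD]; rfl
  rw [hlam] at hlow
  have hmain := (ratio_le_lower_bound hr0 hrs).trans hlow
  have hhalf := half_le_ratio hr0 hrs
  have htwo : rk ≤ 2 * lamk := by
    rw [mul_div_right_comm] at hmain
    nlinarith [mul_le_mul_of_nonneg_right hhalf hr0]
  exact ⟨hmain, hhalf, htwo, fun eps heps => by linarith⟩
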